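/- arXiv:1509.02328 — 2 statements merged into one kernel-verified Lean document; each statement's English description precedes it below -/
import Mathlib

section
/- Let a ≥ 0 and let f : [0,∞) → ℝ be bounded and uniformly continuous on [0,∞). Then there exists a constant C > 0 such that for all n ∈ ℕ and all x ≥ 0, |K_n^a(f;x) − f(x)| ≤ C·ω₂(f, √(γ_n^a(x))) + ω(f, (1/(n+1))·|−x + ax/(1+x) + 1/2|), where γ_n^a(x) = (1/(n+1)²)·{(n+2)x² + (n−2)x + 2a²x²/(1+x)² − 4ax²/(1+x) + 3ax/(1+x) + 7/12}. -/
open MeasureTheory Filter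

noncomputable section

/-- Rising factorial `(n)_i = n(n+1)⋯(n+i-1)`, with `(n)_0 = 1`. -/
def risingFac (n : ℕ) : ℕ → ℝ
  | 0 => 1
  | i + 1 => risingFac n i * ((n : ℝ) + i)

/-- `P_k(n,a) = Σ_{i=0}^{k} C(k,i) (n)_i a^(k-i)`. -/
def Pba (k n : ℕ) (a : ℝ) : ℝ :=
  ∑ i ∈ Finset.range (k + 1), (k.choose i : ℝ) * risingFac n i * a ^ (k - i)

/-- Generalized Baskakov basis function `W_{n,k}^a(x)`. -/
def Wgb (a : ℝ) (n k : ℕ) (x : ℝ) : ℝ :=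
  Real.exp (-(a * x) / (1 + x)) * (Pba k n a / (Nat.factorial k : ℝ)) * x ^ k /
    (1 + x) ^ (n + k)

/-- Generalized Baskakov–Kantorovich operator `K_n^a(f;x)`. -/
def Kgb (a : ℝ) (n : ℕ) (f : ℝ → ℝ) (x : ℝ) : ℝ :=
  ((n : ℝ) + 1) * ∑' k : ℕ,
    Wgb a n k x * ∫ t in ((k : ℝ) / ((n : ℝ) + 1))..(((k : ℝ) + 1) / ((n : ℝ) + 1)), f t

/-- Usual modulus of continuity on `[0,∞)`: `ω(f,δ) = sup_{0<h≤δ} sup_{x≥0} |f(x+h) - f(x)|`. -/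
def modCont (f : ℝ → ℝ) (δ : ℝ) : ℝ :=
  sSup {y | ∃ h x : ℝ, 0 < h ∧ h ≤ δ ∧ 0 ≤ x ∧ y = |f (x + h) - f x|}

/-- Second order modulus of smoothness on `[0,∞)`:
`ω₂(f,δ) = sup_{0<h≤δ} sup_{x≥0} |f(x+2h) - 2f(x+h) + f(x)|`. -/
def modSmooth2 (f : ℝ → ℝ) (δ : ℝ) : ℝ :=
  sSup {y | ∃ h x : ℝ, 0 < h ∧ h ≤ δ ∧ 0 ≤ x ∧ y = |f (x + 2 * h) - 2 * f (x + h) + f x|}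

/-- `γ_n^a(x)`. -/
def gammaK (a : ℝ) (n : ℕ) (x : ℝ) : ℝ :=
  (1 / ((n : ℝ) + 1) ^ 2) *
    (((n : ℝ) + 2) * x ^ 2 + ((n : ℝ) - 2) * x + 2 * a ^ 2 * x ^ 2 / (1 + x) ^ 2 -
      4 * a * x ^ 2 / (1 + x) + 3 * a * x / (1 + x) + 7 / 12)

/-! ### Generating function and moments of the basis functions -/

lemma risingFac_succ_left (n i : ℕ) : risingFac n (i + 1) = n * risingFac (n + 1) i := by
  induction i with
  | zero => simp [risingFac]
  | succ i ih =>
    rw [risingFac, ih, risingFac]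
    push_cast
    ring

lemma risingFac_nonneg (n i : ℕ) : 0 ≤ risingFac n i := by
  induction i with
  | zero => simp [risingFac]
  | succ i ih => rw [risingFac]; positivity

lemma risingFac_succ_div_factorial (m i : ℕ) :
    risingFac (m + 1) i / (i.factorial : ℝ) = ((i + m).choose m : ℝ) := by
  have h : risingFac (m + 1) i = ((m + 1).ascFactorial i : ℝ) := by
    induction i with
    | zero => simp [risingFac]
    | succ i ih =>
      rw [risingFac, ih, Nat.ascFactorial_succ]
      push_cast
      ring
  rw [h, Nat.ascFactorial_eq_factorial_mul_choose, Nat.cast_mul,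
    mul_div_cancel_left₀ _ (by positivity), add_comm m i, Nat.choose_symm_add]

lemma hasSum_risingFac (n : ℕ) {y : ℝ} (hy : 0 ≤ y) (hy1 : y < 1) :
    HasSum (fun i : ℕ => risingFac n i / (i.factorial : ℝ) * y ^ i) (1 / (1 - y) ^ n) := by
  rcases n with _ | m
  · have h : ∀ i : ℕ, i ≠ 0 → risingFac 0 i / (i.factorial : ℝ) * y ^ i = 0 := by
      rintro (_ | i) hi
      · exact absurd rfl hi
      · simp [risingFac_succ_left]
    simpa [risingFac] using hasSum_single 0 h
  · simp_rw [risingFac_succ_div_factorial]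
    exact hasSum_choose_mul_geometric_of_norm_lt_one m
      (by rwa [Real.norm_eq_abs, abs_of_nonneg hy])

lemma Pba_div_factorial (k n : ℕ) (a : ℝ) :
    Pba k n a / (k.factorial : ℝ) = ∑ i ∈ Finset.range (k + 1),
      risingFac n i / (i.factorial : ℝ) * (a ^ (k - i) / ((k - i).factorial : ℝ)) := by
  rw [Pba, Finset.sum_div]
  refine Finset.sum_congr rfl fun i hi => ?_
  rw [Nat.cast_choose ℝ (Nat.lt_succ_iff.mp (Finset.mem_range.mp hi))]
  field_simp

lemma Pba_nonneg (k n : ℕ) {a : ℝ} (ha : 0 ≤ a) : 0 ≤ Pba k n a :=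
  Finset.sum_nonneg fun i _ => by have := risingFac_nonneg n i; positivity

/-- The coefficient identity expressing the derivative of `exp (a y) * (1 - y)⁻ⁿ`. -/
lemma succ_mul_Pba_div_factorial (k n : ℕ) (a : ℝ) :
    ((k : ℝ) + 1) * (Pba (k + 1) n a / ((k + 1).factorial : ℝ)) =
      a * (Pba k n a / (k.factorial : ℝ)) + n * (Pba k (n + 1) a / (k.factorial : ℝ)) := by
  simp only [Pba_div_factorial]
  have hsplit : ((k : ℝ) + 1) * ∑ i ∈ Finset.range (k + 1 + 1),
      risingFac n i / (i.factorial : ℝ) * (a ^ (k + 1 - i) / ((k + 1 - i).factorial : ℝ)) =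
      (∑ i ∈ Finset.range (k + 1 + 1), ((k + 1 - i : ℕ) : ℝ) * (risingFac n i / (i.factorial : ℝ)
        * (a ^ (k + 1 - i) / ((k + 1 - i).factorial : ℝ)))) +
      ∑ i ∈ Finset.range (k + 1 + 1), (i : ℝ) * (risingFac n i / (i.factorial : ℝ)
        * (a ^ (k + 1 - i) / ((k + 1 - i).factorial : ℝ))) := by
    rw [Finset.mul_sum, ← Finset.sum_add_distrib]
    refine Finset.sum_congr rfl fun i hi => ?_
    rw [Nat.cast_sub (Nat.lt_succ_iff.mp (Finset.mem_range.mp hi))]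
    push_cast
    ring
  rw [hsplit, Finset.sum_range_succ, Finset.sum_range_succ' _ (k + 1)]
  simp only [Nat.sub_self, Nat.cast_zero, zero_mul, add_zero, Finset.mul_sum]
  congr 1
  · refine Finset.sum_congr rfl fun i hi => ?_
    have hi' : i ≤ k := Nat.lt_succ_iff.mp (Finset.mem_range.mp hi)
    rw [Nat.succ_sub hi', Nat.factorial_succ, pow_succ]
    push_cast
    field_simp
  · refine Finset.sum_congr rfl fun i _ => ?_
    rw [Nat.add_sub_add_right, risingFac_succ_left, Nat.factorial_succ]
    push_cast
    field_simp

lemma hasSum_Pba (n : ℕ) (a : ℝ) {y : ℝ} (hy : 0 ≤ y) (hy1 : y < 1) :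
    HasSum (fun k : ℕ => Pba k n a / (k.factorial : ℝ) * y ^ k)
      (Real.exp (a * y) / (1 - y) ^ n) := by
  have hr := hasSum_risingFac n hy hy1
  have he : HasSum (fun j : ℕ => (a * y) ^ j / (j.factorial : ℝ)) (Real.exp (a * y)) := by
    rw [Real.exp_eq_exp_ℝ]
    exact NormedSpace.expSeries_div_hasSum_exp (a * y)
  have hprod := hasSum_sum_range_mul_of_summable_norm hr.summable.norm he.summable.norm
  rw [hr.tsum_eq, he.tsum_eq] at hprod
  convert! hprod using 1
  · funext k
    rw [Pba_div_factorial, Finset.sum_mul]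
    refine Finset.sum_congr rfl fun i hi => ?_
    rw [← Nat.add_sub_cancel' (Nat.lt_succ_iff.mp (Finset.mem_range.mp hi)), pow_add y,
      Nat.add_sub_cancel_left, mul_pow]
    ring
  · ring

lemma hasSum_natCast_mul {b c : ℕ → ℝ} {y s : ℝ} (h : ∀ k : ℕ, ((k : ℝ) + 1) * b (k + 1) = c k)
    (hc : HasSum (fun k => c k * y ^ k) s) :
    HasSum (fun k : ℕ => (k : ℝ) * b k * y ^ k) (y * s) := by
  rw [← hasSum_nat_add_iff' 1]
  simpa [h, pow_succ, mul_assoc, mul_comm, mul_left_comm] using hc.mul_left y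

lemma hasSum_mul_Pba (n : ℕ) (a : ℝ) {y : ℝ} (hy : 0 ≤ y) (hy1 : y < 1) :
    HasSum (fun k : ℕ => (k : ℝ) * (Pba k n a / (k.factorial : ℝ)) * y ^ k)
      (y * (a * (Real.exp (a * y) / (1 - y) ^ n) +
        n * (Real.exp (a * y) / (1 - y) ^ (n + 1)))) := by
  refine hasSum_natCast_mul (fun k => succ_mul_Pba_div_factorial k n a) ?_
  simpa only [add_mul, mul_assoc] using
    ((hasSum_Pba n a hy hy1).mul_left a).add ((hasSum_Pba (n + 1) a hy hy1).mul_left (n : ℝ))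

lemma hasSum_sq_mul_Pba (n : ℕ) (a : ℝ) {y : ℝ} (hy : 0 ≤ y) (hy1 : y < 1) :
    HasSum (fun k : ℕ => (k : ℝ) ^ 2 * (Pba k n a / (k.factorial : ℝ)) * y ^ k)
      (y * (a * (y * (a * (Real.exp (a * y) / (1 - y) ^ n) +
          n * (Real.exp (a * y) / (1 - y) ^ (n + 1))) + Real.exp (a * y) / (1 - y) ^ n) +
        n * (y * (a * (Real.exp (a * y) / (1 - y) ^ (n + 1)) +
          ((n : ℝ) + 1) * (Real.exp (a * y) / (1 - y) ^ (n + 2))) +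
          Real.exp (a * y) / (1 - y) ^ (n + 1)))) := by
  have h0 := (hasSum_mul_Pba n a hy hy1).add (hasSum_Pba n a hy hy1)
  have h1 := (hasSum_mul_Pba (n + 1) a hy hy1).add (hasSum_Pba (n + 1) a hy hy1)
  have key := hasSum_natCast_mul (y := y) (b := fun k => (k : ℝ) * (Pba k n a / (k.factorial : ℝ)))
    (c := fun k => ((k : ℝ) + 1) * (a * (Pba k n a / (k.factorial : ℝ)) +
      n * (Pba k (n + 1) a / (k.factorial : ℝ))))
    (fun k => by rw [← succ_mul_Pba_div_factorial]; push_cast; ring)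
    (((h0.mul_left a).add (h1.mul_left (n : ℝ))).congr_fun fun k => by ring)
  convert! key using 1
  · funext k; ring
  · push_cast; ring

lemma Wgb_eq (a : ℝ) (n k : ℕ) {x : ℝ} (hx : 0 ≤ x) :
    Wgb a n k x = Real.exp (-(a * (x / (1 + x)))) * (1 - x / (1 + x)) ^ n *
      (Pba k n a / (k.factorial : ℝ) * (x / (1 + x)) ^ k) := by
  have h : 1 - x / (1 + x) = 1 / (1 + x) := by field_simp; ring
  rw [Wgb, h, div_pow, div_pow, one_pow, pow_add, neg_div, mul_div_assoc a]
  field_simp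

lemma Wgb_nonneg {a : ℝ} (ha : 0 ≤ a) (n k : ℕ) {x : ℝ} (hx : 0 ≤ x) : 0 ≤ Wgb a n k x := by
  have := Pba_nonneg k n ha
  rw [Wgb]
  positivity

lemma hasSum_Wgb_mul_quadratic (a : ℝ) (n : ℕ) {x : ℝ} (hx : 0 ≤ x) (α β γ : ℝ) :
    HasSum (fun k : ℕ => Wgb a n k x * (α + β * k + γ * (k : ℝ) ^ 2))
      (α + β * (a * x / (1 + x) + n * x) +
        γ * ((a * x / (1 + x) + n * x) ^ 2 + a * x / (1 + x) + n * x * (1 + x))) := by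
  obtain ⟨y, hy⟩ : ∃ y, y = x / (1 + x) := ⟨_, rfl⟩
  have hy0 : 0 ≤ y := hy ▸ by positivity
  have hq : 1 - y = 1 / (1 + x) := by rw [hy]; field_simp; ring
  have hy1 : y < 1 := by
    have : 0 < 1 - y := hq ▸ by positivity
    linarith
  have hyx : y * (1 + x) = x := by rw [hy]; field_simp
  have h0 := (hasSum_Pba n a hy0 hy1).mul_left α
  have h1 := (hasSum_mul_Pba n a hy0 hy1).mul_left β
  have h2 := (hasSum_sq_mul_Pba n a hy0 hy1).mul_left γ
  have key := ((h0.add h1).add h2).mul_left (Real.exp (-(a * y)) * (1 - y) ^ n)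
  convert! key using 1
  · funext k
    rw [Wgb_eq a n k hx, ← hy]
    ring
  · have hE : Real.exp (-(a * y)) * Real.exp (a * y) = 1 := by rw [← Real.exp_add]; simp
    have hdiv : ∀ m : ℕ, Real.exp (a * y) / (1 - y) ^ m = Real.exp (a * y) * (1 + x) ^ m := by
      intro m
      rw [hq, one_div, inv_pow, div_inv_eq_mul]
    have hpow : (1 - y) ^ n * (1 + x) ^ n = 1 := by
      rw [← mul_pow, hq, one_div_mul_cancel (by positivity), one_pow]
    simp only [hdiv, mul_div_assoc, ← hy]
    generalize Real.exp (-(a * y)) = E' at hE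
    generalize Real.exp (a * y) = E at hE
    generalize (1 - y) ^ n = q at hpow
    simp only [pow_succ]
    generalize (1 + x) ^ n = r at hpow
    have hc : E' * q * (E * r) = 1 := by linear_combination hpow + q * r * hE
    have hS : y * (a + n * (1 + x)) = a * y + n * x := by linear_combination (n : ℝ) * hyx
    have hT : y * (a + (n + 1) * (1 + x)) = a * y + (n + 1) * x := by
      linear_combination ((n : ℝ) + 1) * hyx
    have hsq : y * (a * (y * (a + n * (1 + x)) + 1) +
        n * (1 + x) * (y * (a + (n + 1) * (1 + x)) + 1)) =
        (a * y + n * x) ^ 2 + a * y + n * x * (1 + x) := by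
      rw [hS, hT]
      linear_combination ((n : ℝ) * (a * y + (n + 1) * x + 1)) * hyx
    linear_combination -(α + β * (y * (a + n * (1 + x))) + γ * (y * (a * (y * (a + n * (1 + x)) + 1)
      + n * (1 + x) * (y * (a + (n + 1) * (1 + x)) + 1)))) * hc - β * hS - γ * hsq

/-! ### The operator is close to point evaluation on functions close to an affine function -/

lemma integral_quadratic (c p r x u v : ℝ) :
    ∫ t in u..v, (c + p * (t - x) + r * (t - x) ^ 2) =
      c * (v - u) + p * ((v - x) ^ 2 - (u - x) ^ 2) / 2 +
        r * ((v - x) ^ 3 - (u - x) ^ 3) / 3 := by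
  have hderiv : ∀ t ∈ Set.uIcc u v, HasDerivAt
      (fun t => c * t + p * (t - x) ^ 2 / 2 + r * (t - x) ^ 3 / 3)
      (c + p * (t - x) + r * (t - x) ^ 2) t := by
    intro t _
    have h := (hasDerivAt_id t).sub_const x
    have := (((hasDerivAt_id t).const_mul c).add (((h.pow 2).const_mul p).div_const 2)).add
      (((h.pow 3).const_mul r).div_const 3)
    refine this.congr_deriv ?_
    simp
    ring
  rw [intervalIntegral.integral_eq_sub_of_hasDerivAt hderiv
    (Continuous.intervalIntegrable (by fun_prop) _ _)]
  ring

lemma abs_Kgb_sub_affine_le {a : ℝ} (ha : 0 ≤ a) (n : ℕ) {x : ℝ} (hx : 0 ≤ x) {f : ℝ → ℝ}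
    (hf : ContinuousOn f (Set.Ici 0)) {p A B : ℝ}
    (hfp : ∀ t, 0 ≤ t → |f t - f x - p * (t - x)| ≤ A + B * (t - x) ^ 2) :
    |Kgb a n f x - f x - p * ((1 / ((n : ℝ) + 1)) * (-x + a * x / (1 + x) + 1 / 2))| ≤
      A + B * (gammaK a n x -
        ((1 / ((n : ℝ) + 1)) * (-x + a * x / (1 + x) + 1 / 2)) ^ 2) := by
  have hN : (0 : ℝ) < (n : ℝ) + 1 := by positivity
  have hcell : ∀ k : ℕ,
      |((n : ℝ) + 1) * (∫ t in ((k : ℝ) / ((n : ℝ) + 1))..(((k : ℝ) + 1) / ((n : ℝ) + 1)), f t) -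
        (f x + p * ((k + 1 / 2) / ((n : ℝ) + 1) - x))| ≤
      A + B * (((k + 1 / 2) / ((n : ℝ) + 1) - x) ^ 2 + 1 / (12 * ((n : ℝ) + 1) ^ 2)) := by
    intro k
    have huv : (k : ℝ) / ((n : ℝ) + 1) ≤ ((k : ℝ) + 1) / ((n : ℝ) + 1) := by gcongr; linarith
    have hu : 0 ≤ (k : ℝ) / ((n : ℝ) + 1) := by positivity
    have hfi : IntervalIntegrable f volume ((k : ℝ) / ((n : ℝ) + 1))
        (((k : ℝ) + 1) / ((n : ℝ) + 1)) := by
      refine (hf.mono fun t ht => ?_).intervalIntegrable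
      rw [Set.uIcc_of_le huv] at ht
      exact hu.trans ht.1
    have hbound := intervalIntegral.norm_integral_le_of_norm_le (μ := volume)
      (f := fun t => f t - (f x + p * (t - x) + 0 * (t - x) ^ 2))
      (g := fun t => A + 0 * (t - x) + B * (t - x) ^ 2) huv
      (Filter.Eventually.of_forall fun t ht => by
        have := hfp t (hu.trans ht.1.le)
        rw [Real.norm_eq_abs]
        convert! this using 1
        · congr 1; ring
        · ring)
      (Continuous.intervalIntegrable (by fun_prop) _ _)
    rw [intervalIntegral.integral_sub hfi (Continuous.intervalIntegrable (by fun_prop) _ _),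
      integral_quadratic, integral_quadratic, Real.norm_eq_abs] at hbound
    have hmul := mul_le_mul_of_nonneg_left hbound hN.le
    rw [← abs_of_pos hN, ← abs_mul, abs_of_pos hN] at hmul
    convert! hmul using 1
    · congr 1
      field_simp
      ring
    · field_simp
      ring
  have haff := hasSum_Wgb_mul_quadratic a n hx (f x + p * (1 / 2 / ((n : ℝ) + 1) - x))
    (p / ((n : ℝ) + 1)) 0
  have hquad := hasSum_Wgb_mul_quadratic a n hx
    (A + B * ((1 / 2 / ((n : ℝ) + 1) - x) ^ 2 + 1 / (12 * ((n : ℝ) + 1) ^ 2)))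
    (2 * B * (1 / 2 / ((n : ℝ) + 1) - x) / ((n : ℝ) + 1)) (B / ((n : ℝ) + 1) ^ 2)
  obtain ⟨D, hD⟩ : ∃ D : ℕ → ℝ, D = fun k : ℕ => Wgb a n k x * (((n : ℝ) + 1) *
      (∫ t in ((k : ℝ) / ((n : ℝ) + 1))..(((k : ℝ) + 1) / ((n : ℝ) + 1)), f t) -
        (f x + p * ((k + 1 / 2) / ((n : ℝ) + 1) - x))) := ⟨_, rfl⟩
  have hDle : ∀ k : ℕ, ‖D k‖ ≤ Wgb a n k x *
      (A + B * ((1 / 2 / ((n : ℝ) + 1) - x) ^ 2 + 1 / (12 * ((n : ℝ) + 1) ^ 2)) +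
        2 * B * (1 / 2 / ((n : ℝ) + 1) - x) / ((n : ℝ) + 1) * k +
        B / ((n : ℝ) + 1) ^ 2 * (k : ℝ) ^ 2) := by
    intro k
    have hW := Wgb_nonneg ha n k hx
    rw [hD, Real.norm_eq_abs, abs_mul, abs_of_nonneg hW]
    refine mul_le_mul_of_nonneg_left ((hcell k).trans_eq ?_) hW
    generalize (n : ℝ) + 1 = N
    ring
  have hDsum : HasSum D (∑' k, D k) := (Summable.of_norm_bounded hquad.summable hDle).hasSum
  have hDtsum := tsum_of_norm_bounded hquad hDle
  have hK : HasSum (fun k : ℕ => ((n : ℝ) + 1) * (Wgb a n k x *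
      ∫ t in ((k : ℝ) / ((n : ℝ) + 1))..(((k : ℝ) + 1) / ((n : ℝ) + 1)), f t)) _ :=
    (hDsum.add haff).congr_fun fun k => by rw [hD]; ring
  have hKgb := hK.tsum_eq
  rw [tsum_mul_left, ← Kgb] at hKgb
  rw [Real.norm_eq_abs] at hDtsum
  convert! hDtsum using 1
  · rw [hKgb]
    congr 1
    field_simp
    ring
  · rw [gammaK]
    field_simp
    ring

lemma gammaK_eq (a : ℝ) (n : ℕ) {x : ℝ} (hx : 0 ≤ x) :
    gammaK a n x = 2 * ((1 / ((n : ℝ) + 1)) * (-x + a * x / (1 + x) + 1 / 2)) ^ 2 +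
      (1 / ((n : ℝ) + 1)) ^ 2 * (n * x * (1 + x) + a * x / (1 + x) + 1 / 12) := by
  rw [gammaK]
  field_simp
  ring

/-! ### Functions with small second differences are locally close to affine functions -/

lemma abs_le_of_second_diff {u : ℕ → ℝ} {w : ℝ} {N : ℕ} (h0 : |u 0| ≤ w)
    (h1 : 1 ≤ N → |u 1| ≤ 3 * w)
    (h2 : ∀ i, i + 2 ≤ N → |u (i + 2) - 2 * u (i + 1) + u i| ≤ w) :
    |u N| ≤ w * (1 + 4 * N + (N : ℝ) ^ 2) := by
  have hw : 0 ≤ w := (abs_nonneg _).trans h0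
  have hd : ∀ j : ℕ, j + 1 ≤ N → |u (j + 1) - u j| ≤ (4 + j) * w := by
    intro j
    induction j with
    | zero =>
      intro hj
      have := abs_sub (u 1) (u 0)
      have := h1 hj
      simp only [zero_add, Nat.cast_zero, add_zero]
      linarith
    | succ j ih =>
      intro hj
      have h := abs_add_le (u (j + 2) - 2 * u (j + 1) + u j) (u (j + 1) - u j)
      have h' := ih (by omega)
      have h'' := h2 j hj
      rw [show u (j + 2) - 2 * u (j + 1) + u j + (u (j + 1) - u j) = u (j + 1 + 1) - u (j + 1) by
        ring_nf] at h
      push_cast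
      linarith
  have hj : ∀ j : ℕ, j ≤ N → |u j| ≤ w * (1 + 4 * j + (j : ℝ) ^ 2) := by
    intro j
    induction j with
    | zero => intro _; simpa using h0
    | succ j ih =>
      intro hj
      have h := abs_add_le (u (j + 1) - u j) (u j)
      rw [sub_add_cancel] at h
      have h' := ih (by omega)
      have h'' := hd j hj
      have : 0 ≤ w * j := by positivity
      push_cast
      nlinarith
  exact hj N le_rfl

lemma abs_le_of_second_diff_on_Icc {g : ℝ → ℝ} {x δ w M : ℝ} (hδ : 0 < δ) (hx : 0 ≤ x)
    (hM : ∀ t ∈ Set.Icc x (x + δ), |g t| ≤ M) (hgx : g x = 0) (hgδ : g (x + δ) = 0)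
    (hg : ∀ h s, 0 < h → h ≤ δ → 0 ≤ s → |g (s + 2 * h) - 2 * g (s + h) + g s| ≤ w)
    {t : ℝ} (ht : t ∈ Set.Icc x (x + δ)) : |g t| ≤ w := by
  have hbdd : BddAbove ((fun t => |g t|) '' Set.Icc x (x + δ)) := by
    refine ⟨M, ?_⟩
    rintro _ ⟨s, hs, rfl⟩
    exact hM s hs
  obtain ⟨S, hS⟩ : ∃ S, S = sSup ((fun t => |g t|) '' Set.Icc x (x + δ)) := ⟨_, rfl⟩
  have hle : ∀ s ∈ Set.Icc x (x + δ), |g s| ≤ S :=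
    fun s hs => hS ▸ le_csSup hbdd ⟨s, hs, rfl⟩
  have hw : 0 ≤ w := (abs_nonneg _).trans (hg δ x hδ le_rfl hx)
  have hS0 : 0 ≤ S := (abs_nonneg _).trans (hle t ht)
  have hhalf : ∀ s ∈ Set.Icc x (x + δ), |g s| ≤ (S + w) / 2 := by
    rintro s ⟨hs1, hs2⟩
    rcases eq_or_lt_of_le hs1 with rfl | hs1'
    · rw [hgx, abs_zero]; linarith
    rcases eq_or_lt_of_le hs2 with rfl | hs2'
    · rw [hgδ, abs_zero]; linarith
    rcases le_total (s - x) (δ / 2) with h | h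
    · have h1 := hg (s - x) x (by linarith) (by linarith) hx
      have h2 := hle (x + 2 * (s - x)) ⟨by linarith, by linarith⟩
      rw [add_sub_cancel, hgx] at h1
      rw [abs_le] at *
      constructor <;> linarith [h1.1, h1.2, h2.1, h2.2]
    · have h1 := hg (x + δ - s) (2 * s - x - δ) (by linarith) (by linarith) (by linarith)
      have h2 := hle (2 * s - x - δ) ⟨by linarith, by linarith⟩
      rw [show 2 * s - x - δ + 2 * (x + δ - s) = x + δ by ring,
        show 2 * s - x - δ + (x + δ - s) = s by ring, hgδ] at h1
      rw [abs_le] at *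
      constructor <;> linarith [h1.1, h1.2, h2.1, h2.2]
  have hSle : S ≤ (S + w) / 2 := by
    rw [hS]
    refine csSup_le ⟨_, t, ht, rfl⟩ ?_
    rintro _ ⟨s, hs, rfl⟩
    rw [← hS]
    exact hhalf s hs
  linarith [hle t ht]

/-- A function with second differences bounded by `w` at scale `δ`, vanishing at `x` and `x + δ`,
grows at most quadratically. -/
lemma abs_le_quadratic_of_second_diff {g : ℝ → ℝ} {x δ w M : ℝ} (hδ : 0 < δ) (hx : 0 ≤ x)
    (hM : ∀ t ∈ Set.Icc x (x + δ), |g t| ≤ M) (hgx : g x = 0) (hgδ : g (x + δ) = 0)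
    (hg : ∀ h s, 0 < h → h ≤ δ → 0 ≤ s → |g (s + 2 * h) - 2 * g (s + h) + g s| ≤ w)
    {t : ℝ} (ht : 0 ≤ t) : |g t| ≤ 9 * w + 4 * w / δ ^ 2 * (t - x) ^ 2 := by
  have hw : 0 ≤ w := (abs_nonneg _).trans (hg δ x hδ le_rfl hx)
  have hcell : ∀ {s}, s ∈ Set.Icc x (x + δ) → |g s| ≤ w :=
    abs_le_of_second_diff_on_Icc hδ hx hM hgx hgδ hg
  have hright : ∀ s ∈ Set.Icc (x + δ) (x + 2 * δ), |g s| ≤ 3 * w := by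
    rintro s ⟨hs1, hs2⟩
    have h1 := hg ((s - x) / 2) x (by linarith) (by linarith) hx
    have h2 := hcell (s := x + (s - x) / 2) ⟨by linarith, by linarith⟩
    rw [show x + 2 * ((s - x) / 2) = s by ring, hgx] at h1
    rw [abs_le] at *
    constructor <;> linarith [h1.1, h1.2, h2.1, h2.2]
  have hleft : ∀ s ∈ Set.Icc (x - δ) x, 0 ≤ s → |g s| ≤ 3 * w := by
    rintro s ⟨hs1, hs2⟩ hs0
    have h1 := hg ((x + δ - s) / 2) s (by linarith) (by linarith) hs0
    have h2 := hcell (s := s + (x + δ - s) / 2) ⟨by linarith, by linarith⟩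
    rw [show s + 2 * ((x + δ - s) / 2) = x + δ by ring, hgδ] at h1
    rw [abs_le] at *
    constructor <;> linarith [h1.1, h1.2, h2.1, h2.2]
  have hfinal : ∀ (N : ℕ) (r : ℝ), 0 ≤ r → (N : ℝ) ≤ r + 1 → r ^ 2 = (t - x) ^ 2 / δ ^ 2 →
      |g t| ≤ w * (1 + 4 * N + (N : ℝ) ^ 2) → |g t| ≤ 9 * w + 4 * w / δ ^ 2 * (t - x) ^ 2 := by
    intro N r hr hNr hr2 hgt
    have hN : (1 + 4 * N + (N : ℝ) ^ 2) ≤ 9 + 4 * r ^ 2 := by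
      have : (N : ℝ) ^ 2 ≤ (r + 1) ^ 2 := by gcongr
      nlinarith [sq_nonneg (r - 1)]
    calc |g t| ≤ w * (9 + 4 * r ^ 2) := hgt.trans (mul_le_mul_of_nonneg_left hN hw)
      _ = 9 * w + 4 * w / δ ^ 2 * (t - x) ^ 2 := by rw [hr2]; ring
  rcases le_total x t with hxt | htx
  · obtain ⟨N, hN⟩ : ∃ N, N = ⌊(t - x) / δ⌋₊ := ⟨_, rfl⟩
    have hr : 0 ≤ (t - x) / δ := div_nonneg (by linarith) hδ.le
    have hN1 : (N : ℝ) * δ ≤ t - x := by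
      rw [← le_div_iff₀ hδ, hN]; exact Nat.floor_le hr
    have hN2 : t - x < ((N : ℝ) + 1) * δ := by
      rw [← div_lt_iff₀ hδ, hN]; exact Nat.lt_floor_add_one _
    refine hfinal N ((t - x) / δ) hr (by linarith [(le_div_iff₀ hδ).2 hN1]) (div_pow _ _ _) ?_
    have key := abs_le_of_second_diff (u := fun j : ℕ => g (t - N * δ + j * δ)) (w := w) (N := N)
      (by
        refine hcell ⟨?_, ?_⟩ <;> simp only [Nat.cast_zero] <;> linarith)
      (fun _ => by
        refine hright _ ⟨?_, ?_⟩ <;> simp only [Nat.cast_one] <;> linarith)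
      (fun i _ => by
        have hi : 0 ≤ (i : ℝ) * δ := by positivity
        have := hg δ (t - N * δ + i * δ) hδ le_rfl (by linarith)
        rw [show t - N * δ + i * δ + 2 * δ = t - N * δ + (i + 2) * δ by ring,
          show t - N * δ + i * δ + δ = t - N * δ + (i + 1) * δ by ring] at this
        exact_mod_cast this)
    simpa using key
  · obtain ⟨N, hN⟩ : ∃ N, N = ⌈(x - t) / δ⌉₊ := ⟨_, rfl⟩
    have hr : 0 ≤ (x - t) / δ := div_nonneg (by linarith) hδ.le
    have hN1 : x - t ≤ (N : ℝ) * δ := by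
      rw [← div_le_iff₀ hδ, hN]; exact Nat.le_ceil _
    have hN2 : (N : ℝ) < (x - t) / δ + 1 := hN ▸ Nat.ceil_lt_add_one hr
    have hN3 : (N : ℝ) * δ < x - t + δ := by
      have := mul_lt_mul_of_pos_right hN2 hδ
      rwa [add_mul, div_mul_cancel₀ _ hδ.ne', one_mul] at this
    refine hfinal N ((x - t) / δ) hr hN2.le (by rw [div_pow]; ring) ?_
    have key := abs_le_of_second_diff (u := fun j : ℕ => g (t + N * δ - j * δ)) (w := w) (N := N)
      (by
        refine hcell ⟨?_, ?_⟩ <;> simp only [Nat.cast_zero] <;> linarith)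
      (fun h => by
        have h' : (1 : ℝ) * δ ≤ (N : ℝ) * δ := by gcongr; exact_mod_cast h
        refine hleft _ ⟨?_, ?_⟩ ?_ <;> simp only [Nat.cast_one] <;> linarith)
      (fun i hi => by
        have hi' : ((i : ℝ) + 2) * δ ≤ (N : ℝ) * δ := by gcongr; exact_mod_cast hi
        have := hg δ (t + N * δ - (i + 2) * δ) hδ le_rfl (by linarith)
        rw [show t + N * δ - (i + 2) * δ + 2 * δ = t + N * δ - i * δ by ring,
          show t + N * δ - (i + 2) * δ + δ = t + N * δ - (i + 1) * δ by ring] at this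
        push_cast
        rw [abs_le] at *
        constructor <;> linarith [this.1, this.2])
    simpa using key

lemma le_modSmooth2 {f : ℝ → ℝ} {M : ℝ} (hM : ∀ x : ℝ, 0 ≤ x → |f x| ≤ M) {δ h s : ℝ}
    (hh : 0 < h) (hδ : h ≤ δ) (hs : 0 ≤ s) :
    |f (s + 2 * h) - 2 * f (s + h) + f s| ≤ modSmooth2 f δ := by
  refine le_csSup ⟨4 * M, ?_⟩ ⟨h, s, hh, hδ, hs, rfl⟩
  rintro _ ⟨h, x, hh, -, hx, rfl⟩
  have h1 := abs_le.1 (hM (x + 2 * h) (by positivity))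
  have h2 := abs_le.1 (hM (x + h) (by positivity))
  have h3 := abs_le.1 (hM x hx)
  rw [abs_le]
  constructor <;> linarith [h1.1, h1.2, h2.1, h2.2, h3.1, h3.2]

lemma abs_sub_le_modCont {f : ℝ → ℝ} {M : ℝ} (hM : ∀ x : ℝ, 0 ≤ x → |f x| ≤ M) {x y : ℝ}
    (hx : 0 ≤ x) (hy : 0 ≤ y) : |f y - f x| ≤ modCont f |y - x| := by
  have hle : ∀ h s : ℝ, 0 < h → 0 ≤ s → |f (s + h) - f s| ≤ modCont f h := by
    intro h s hh hs
    refine le_csSup ⟨2 * M, ?_⟩ ⟨h, s, hh, le_rfl, hs, rfl⟩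
    rintro _ ⟨h, x, hh, -, hx, rfl⟩
    have h1 := abs_le.1 (hM (x + h) (by positivity))
    have h2 := abs_le.1 (hM x hx)
    rw [abs_le]
    constructor <;> linarith [h1.1, h1.2, h2.1, h2.2]
  rcases lt_trichotomy x y with h | rfl | h
  · have := hle (y - x) x (by linarith) hx
    rw [abs_of_pos (sub_pos.2 h)]
    rwa [add_sub_cancel] at this
  · rw [sub_self, abs_zero]
    refine Real.sSup_nonneg ?_
    rintro _ ⟨h, x, -, -, -, rfl⟩
    exact abs_nonneg _
  · have := hle (x - y) y (by linarith) hy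
    rwa [add_sub_cancel, abs_sub_comm (f x), ← abs_of_pos (sub_pos.2 h), abs_sub_comm x] at this

/-- A bounded function is affine up to its second modulus of smoothness and a quadratic error. -/
lemma exists_abs_sub_affine_le {f : ℝ → ℝ} {M : ℝ} (hM : ∀ x : ℝ, 0 ≤ x → |f x| ≤ M) {x δ : ℝ}
    (hx : 0 ≤ x) (hδ : 0 < δ) : ∃ p : ℝ, ∀ t, 0 ≤ t → |f t - f x - p * (t - x)| ≤
      9 * modSmooth2 f δ + 4 * modSmooth2 f δ / δ ^ 2 * (t - x) ^ 2 := by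
  obtain ⟨p, hp⟩ : ∃ p, p = (f (x + δ) - f x) / δ := ⟨_, rfl⟩
  have hpδ : p * δ = f (x + δ) - f x := by rw [hp]; field_simp
  refine ⟨p, fun t ht => abs_le_quadratic_of_second_diff
    (g := fun t => f t - f x - p * (t - x)) (M := 2 * M + |p| * δ) hδ hx ?_ ?_ ?_ ?_ ht⟩
  · rintro s ⟨hs1, hs2⟩
    have h1 := hM s (hx.trans hs1)
    have h2 := hM x hx
    have h3 : |p * (s - x)| ≤ |p| * δ := by
      rw [abs_mul, abs_of_nonneg (sub_nonneg.2 hs1)]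
      gcongr
      linarith
    have h4 := abs_sub (f s - f x) (p * (s - x))
    have h5 := abs_sub (f s) (f x)
    linarith
  · simp
  · simp [hpδ]
  · intro h s hh hhδ hs
    have := le_modSmooth2 hM hh hhδ hs
    convert! this using 2
    ring

/-- local approximation of bounded uniformly continuous functions. -/
theorem statement0 (a : ℝ) (ha : 0 ≤ a) (f : ℝ → ℝ)
    (hbdd : ∃ M : ℝ, ∀ x : ℝ, 0 ≤ x → |f x| ≤ M)
    (hunif : UniformContinuousOn f (Set.Ici 0)) :
    ∃ C > (0 : ℝ), ∀ (n : ℕ) (x : ℝ), 0 ≤ x →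
      |Kgb a n f x - f x| ≤
        C * modSmooth2 f (Real.sqrt (gammaK a n x)) +
          modCont f ((1 / ((n : ℝ) + 1)) * |-x + a * x / (1 + x) + 1 / 2|) := by
  obtain ⟨M, hM⟩ := hbdd
  refine ⟨22, by norm_num, fun n x hx => ?_⟩
  have hγ := gammaK_eq a n hx
  obtain ⟨m, hm⟩ : ∃ m, m = (1 / ((n : ℝ) + 1)) * (-x + a * x / (1 + x) + 1 / 2) := ⟨_, rfl⟩
  rw [← hm] at hγ
  have hγ0 : 0 < gammaK a n x := by rw [hγ]; positivity
  have hmx : 0 ≤ x + m := by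
    rw [show x + m = (1 / ((n : ℝ) + 1)) * (n * x + a * x / (1 + x) + 1 / 2) by
      rw [hm]; field_simp; ring]
    positivity
  obtain ⟨p, hp⟩ := exists_abs_sub_affine_le hM hx (Real.sqrt_pos.2 hγ0)
  rw [Real.sq_sqrt hγ0.le] at hp
  have h1 := abs_Kgb_sub_affine_le ha n hx hunif.continuousOn hp
  rw [← hm] at h1
  have h2 := hp (x + m) hmx
  have h3 := abs_sub_le_modCont hM hx hmx
  rw [add_sub_cancel_left] at h2 h3
  rw [show 1 / ((n : ℝ) + 1) * |-x + a * x / (1 + x) + 1 / 2| = |m| by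
    rw [hm, abs_mul, abs_of_pos (by positivity : (0 : ℝ) < 1 / ((n : ℝ) + 1))]]
  have h4 : 4 * modSmooth2 f √(gammaK a n x) / gammaK a n x * (gammaK a n x - m ^ 2) =
      4 * modSmooth2 f √(gammaK a n x) -
        4 * modSmooth2 f √(gammaK a n x) / gammaK a n x * m ^ 2 := by
    field_simp
  rw [h4] at h1
  rw [abs_le] at *
  constructor <;> linarith [h1.1, h1.2, h2.1, h2.2, h3.1, h3.2]
end
end

section
/- Let a ≥ 0 and let f : [0,∞) → ℝ be continuous with |f(x)| ≤ M·(1+x²) for all x ≥ 0 and such that lim_{x→∞} f(x)/(1+x²) exists. Then there exists a positive constant M₁ such that for all n ∈ ℕ, sup_{x∈[0,∞)} |K_n^a(f;x) − f(x)|/(1+x²)^{5/2} ≤ M₁·Ω(f, n^{−1/2}), where Ω(f,δ) = sup_{x≥0, 0<h≤δ} |f(x+h) − f(x)|/(1+(x+h)²) is the weighted modulus of continuity. -/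
open MeasureTheory Filter

noncomputable section

/-- Weighted modulus of continuity
`Ω(f,δ) = sup_{x≥0, 0<h≤δ} |f(x+h) − f(x)|/(1+(x+h)²)`. -/
def weightedMod (f : ℝ → ℝ) (δ : ℝ) : ℝ :=
  sSup {y | ∃ x h : ℝ, 0 ≤ x ∧ 0 < h ∧ h ≤ δ ∧ y = |f (x + h) - f x| / (1 + (x + h) ^ 2)}

/-- Negative binomial weights `(n)_i / i! · x^i / (1+x)^(n+i)`. -/
def negBinomialWeight (n : ℕ) (x : ℝ) (i : ℕ) : ℝ :=
  (n.ascFactorial i : ℝ) / (i.factorial : ℝ) * x ^ i / (1 + x) ^ (n + i)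

/-- Poisson weights `e^(-l) l^j / j!`. -/
def poissonWeight (l : ℝ) (j : ℕ) : ℝ :=
  Real.exp (-l) * (l ^ j / (j.factorial : ℝ))

lemma negBinomialWeight_nonneg (n : ℕ) {x : ℝ} (hx : 0 ≤ x) (i : ℕ) :
    0 ≤ negBinomialWeight n x i := by
  unfold negBinomialWeight; positivity

lemma poissonWeight_nonneg {l : ℝ} (hl : 0 ≤ l) (j : ℕ) : 0 ≤ poissonWeight l j := by
  unfold poissonWeight; positivity

lemma risingFac_eq_ascFactorial (n i : ℕ) : risingFac n i = n.ascFactorial i := by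
  induction i with
  | zero => simp [risingFac]
  | succ i ih => rw [risingFac, ih, Nat.ascFactorial_succ]; push_cast; ring

lemma hasSum_negBinomialWeight {n : ℕ} (hn : 1 ≤ n) {x : ℝ} (hx : 0 ≤ x) :
    HasSum (negBinomialWeight n x) 1 := by
  obtain ⟨m, rfl⟩ : ∃ m, n = m + 1 := ⟨n - 1, by omega⟩
  have h1 : (0 : ℝ) < 1 + x := by linarith
  have hz : ‖x / (1 + x)‖ < 1 := by
    rw [Real.norm_of_nonneg (by positivity), div_lt_one h1]; linarith
  have h := (hasSum_choose_mul_geometric_of_norm_lt_one m hz).mul_left (((1 + x) ^ (m + 1))⁻¹)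
  have e : 1 - x / (1 + x) = (1 + x)⁻¹ := by field_simp; ring
  rw [e, inv_pow, one_div, inv_inv, inv_mul_cancel₀ (by positivity)] at h
  convert! h using 1
  ext i
  have hc : ((m + 1).ascFactorial i : ℝ) = i.factorial * ((i + m).choose m : ℕ) := by
    rw [Nat.ascFactorial_eq_factorial_mul_choose, Nat.add_comm m i, Nat.choose_symm_add]
    push_cast; ring
  rw [negBinomialWeight, hc, div_pow]
  field_simp
  ring

/-- Rising factorial moments of the negative binomial weights. -/
lemma hasSum_negBinomialWeight_mul_ascFactorial {n : ℕ} (hn : 1 ≤ n) {x : ℝ} (hx : 0 ≤ x)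
    (r : ℕ) :
    HasSum (fun i => negBinomialWeight n x i * ((n + i).ascFactorial r : ℝ))
      (n.ascFactorial r * (1 + x) ^ r) := by
  have h := (hasSum_negBinomialWeight (n := n + r) (by omega) hx).mul_left
    ((n.ascFactorial r : ℝ) * (1 + x) ^ r)
  rw [mul_one] at h
  convert! h using 1
  ext i
  have h1 : (0 : ℝ) < 1 + x := by linarith
  have e : (n.ascFactorial i : ℝ) * (n + i).ascFactorial r
      = n.ascFactorial r * (n + r).ascFactorial i := by
    exact_mod_cast (Nat.ascFactorial_mul_ascFactorial n i r).trans
      ((congrArg _ (Nat.add_comm i r)).trans (Nat.ascFactorial_mul_ascFactorial n r i).symm)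
  unfold negBinomialWeight
  have e' : (1 + x) ^ (n + r + i) = (1 + x) ^ r * (1 + x) ^ (n + i) := by ring
  rw [e']
  field_simp
  linear_combination x ^ i * e

/-- Variance of the negative binomial weights, with the variable shifted by `n`. -/
lemma hasSum_negBinomialWeight_mul_sq {n : ℕ} (hn : 1 ≤ n) {x : ℝ} (hx : 0 ≤ x) :
    HasSum (fun i => negBinomialWeight n x i * ((i : ℝ) - n * x) ^ 2) (n * x * (1 + x)) := by
  have h0 := hasSum_negBinomialWeight hn hx
  have h1 := hasSum_negBinomialWeight_mul_ascFactorial hn hx 1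
  have h2 := hasSum_negBinomialWeight_mul_ascFactorial hn hx 2
  have h := (h2.sub (h1.mul_left (1 + 2 * (n : ℝ) * (1 + x)))).add
    (h0.mul_left (((n : ℝ) * (1 + x)) ^ 2))
  convert! h using 1
  · ext i
    simp only [Nat.ascFactorial_succ, Nat.ascFactorial_zero]
    push_cast; ring
  · simp only [Nat.ascFactorial_succ, Nat.ascFactorial_zero]
    push_cast; ring

lemma hasSum_pow_div_factorial (l : ℝ) :
    HasSum (fun j : ℕ => l ^ j / (j.factorial : ℝ)) (Real.exp l) := by
  rw [Real.exp_eq_exp_ℝ]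
  exact NormedSpace.expSeries_div_hasSum_exp l

lemma hasSum_poissonWeight (l : ℝ) : HasSum (poissonWeight l) 1 := by
  have h := (hasSum_pow_div_factorial l).mul_left (Real.exp (-l))
  rwa [← Real.exp_add, neg_add_cancel, Real.exp_zero] at h

/-- Exponential moment of the Poisson weights. -/
lemma hasSum_poissonWeight_mul_exp (l : ℝ) :
    HasSum (fun j : ℕ => poissonWeight l j * Real.exp (j + 1))
      (Real.exp (-l) * Real.exp 1 * Real.exp (l * Real.exp 1)) := by
  have h := (hasSum_pow_div_factorial (l * Real.exp 1)).mul_left (Real.exp (-l) * Real.exp 1)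
  convert! h using 1
  ext j
  rw [poissonWeight, Real.exp_add, ← mul_one (j : ℝ), Real.exp_nat_mul, mul_pow]
  ring

/-- The generalized Baskakov weights are a convolution of negative binomial and Poisson weights. -/
lemma Wgb_eq_sum_antidiagonal (a : ℝ) (n k : ℕ) {x : ℝ} (hx : 0 ≤ x) :
    Wgb a n k x = ∑ p ∈ Finset.HasAntidiagonal.antidiagonal k,
      negBinomialWeight n x p.1 * poissonWeight (a * x / (1 + x)) p.2 := by
  rw [Finset.Nat.sum_antidiagonal_eq_sum_range_succ
    (fun i j => negBinomialWeight n x i * poissonWeight (a * x / (1 + x)) j) k]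
  unfold Wgb Pba
  rw [Finset.sum_div, Finset.mul_sum, Finset.sum_mul, Finset.sum_div]
  refine Finset.sum_congr rfl fun i hi => ?_
  have hik : i ≤ k := by have := Finset.mem_range.mp hi; omega
  have h1 : (0 : ℝ) < 1 + x := by linarith
  rw [Nat.cast_choose ℝ hik, risingFac_eq_ascFactorial, negBinomialWeight, poissonWeight, neg_div]
  obtain ⟨m, rfl⟩ := Nat.exists_eq_add_of_le hik
  rw [Nat.add_sub_cancel_left, div_pow, mul_pow, ← Nat.add_assoc, pow_add _ (n + i), pow_add x]
  have hk := Nat.factorial_ne_zero (i + m)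
  field_simp

/-- Summation of `W_{n,k}` against a function of `k` bounded by a function of the two
convolution indices. -/
lemma exists_hasSum_Wgb_mul_of_abs_le {a : ℝ} (ha : 0 ≤ a) (n : ℕ) {x : ℝ} (hx : 0 ≤ x)
    {g : ℕ → ℝ} {B : ℕ × ℕ → ℝ} {S : ℝ}
    (hB : HasSum (fun p : ℕ × ℕ =>
      negBinomialWeight n x p.1 * poissonWeight (a * x / (1 + x)) p.2 * B p) S)
    (hg : ∀ p : ℕ × ℕ, |g (p.1 + p.2)| ≤ B p) :
    ∃ T, |T| ≤ S ∧ HasSum (fun k => Wgb a n k x * g k) T := by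
  set w : ℕ × ℕ → ℝ := fun p =>
    negBinomialWeight n x p.1 * poissonWeight (a * x / (1 + x)) p.2 with hw
  have hw0 : ∀ p, 0 ≤ w p := fun p => mul_nonneg (negBinomialWeight_nonneg n hx _)
    (poissonWeight_nonneg (by positivity) _)
  have hle : ∀ p : ℕ × ℕ, ‖w p * g (p.1 + p.2)‖ ≤ w p * B p := fun p => by
    rw [norm_mul, Real.norm_of_nonneg (hw0 p)]
    exact mul_le_mul_of_nonneg_left (hg p) (hw0 p)
  have hs : Summable fun p : ℕ × ℕ => w p * g (p.1 + p.2) :=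
    Summable.of_norm_bounded hB.summable hle
  refine ⟨_, tsum_of_norm_bounded hB hle, ?_⟩
  have h := Finset.HasAntidiagonal.sigmaAntidiagonalEquivProd.hasSum_iff.mpr hs.hasSum
  convert! h.sigma fun k => hasSum_fintype _ using 1
  ext k
  rw [Wgb_eq_sum_antidiagonal a n k hx, Finset.sum_mul, ← Finset.sum_coe_sort]
  refine Finset.sum_congr rfl fun p _ => ?_
  have := Finset.HasAntidiagonal.mem_antidiagonal.mp p.2
  simp [hw, Finset.HasAntidiagonal.sigmaAntidiagonalEquivProd, this]

lemma hasSum_negBinomialWeight_mul_poissonWeight {n : ℕ} {x l : ℝ} (hx : 0 ≤ x) (hl : 0 ≤ l)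
    {u v : ℕ → ℝ} (hu : 0 ≤ u) (hv : 0 ≤ v) {U V : ℝ}
    (hU : HasSum (fun i => negBinomialWeight n x i * u i) U)
    (hV : HasSum (fun j => poissonWeight l j * v j) V) :
    HasSum (fun p : ℕ × ℕ => negBinomialWeight n x p.1 * poissonWeight l p.2 * (u p.1 * v p.2))
      (U * V) := by
  have h := hU.mul hV (hU.summable.mul_of_nonneg hV.summable
    (fun i => mul_nonneg (negBinomialWeight_nonneg n hx i) (hu i))
    (fun j => mul_nonneg (poissonWeight_nonneg hl j) (hv j)))
  convert! h using 1
  ext p; ring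

lemma hasSum_Wgb {a : ℝ} (ha : 0 ≤ a) {n : ℕ} (hn : 1 ≤ n) {x : ℝ} (hx : 0 ≤ x) :
    HasSum (fun k => Wgb a n k x) 1 := by
  have hl : 0 ≤ a * x / (1 + x) := by positivity
  have h := hasSum_negBinomialWeight_mul_poissonWeight (u := fun _ => 1) (v := fun _ => 1)
    hx hl (fun _ => zero_le_one) (fun _ => zero_le_one)
    (by simpa using hasSum_negBinomialWeight hn hx) (by simpa using hasSum_poissonWeight _)
  have h' := Finset.HasAntidiagonal.sigmaAntidiagonalEquivProd.hasSum_iff.mpr h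
  rw [one_mul] at h'
  convert! h'.sigma fun k => hasSum_fintype _ using 1
  ext k
  rw [Wgb_eq_sum_antidiagonal a n k hx, ← Finset.sum_coe_sort]
  refine Finset.sum_congr rfl fun p _ => ?_
  simp [Finset.HasAntidiagonal.sigmaAntidiagonalEquivProd]

/-- Pointwise error of the operator from a bound on the oscillation of `f` on each cell. -/
lemma abs_Kgb_sub_le {a : ℝ} (ha : 0 ≤ a) {n : ℕ} (hn : 1 ≤ n) {x : ℝ} (hx : 0 ≤ x)
    {f : ℝ → ℝ} (hcont : ContinuousOn f (Set.Ici 0)) {B : ℕ × ℕ → ℝ} {S : ℝ}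
    (hB : HasSum (fun p : ℕ × ℕ =>
      negBinomialWeight n x p.1 * poissonWeight (a * x / (1 + x)) p.2 * B p) S)
    (hf : ∀ (p : ℕ × ℕ) (t : ℝ), (p.1 : ℝ) + p.2 ≤ (n + 1) * t →
      (n + 1) * t ≤ (p.1 : ℝ) + p.2 + 1 → |f t - f x| ≤ B p) :
    |Kgb a n f x - f x| ≤ S := by
  have hn0 : (0 : ℝ) < (n : ℝ) + 1 := by positivity
  have hcell : ∀ k : ℕ, (k : ℝ) / (n + 1) ≤ (k + 1) / (n + 1) := fun k => by gcongr; linarith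
  have hint : ∀ k : ℕ, IntervalIntegrable f volume ((k : ℝ) / (n + 1)) ((k + 1) / (n + 1)) :=
    fun k => (hcont.mono fun t ht => by
      rw [Set.uIcc_of_le (hcell k)] at ht
      exact le_trans (by positivity) ht.1).intervalIntegrable
  have hlen : ∀ k : ℕ, ((k : ℝ) + 1) / (n + 1) - k / (n + 1) = 1 / (n + 1) := fun k => by ring
  set g : ℕ → ℝ := fun k =>
    (n + 1) * (∫ t in ((k : ℝ) / (n + 1))..((k + 1) / (n + 1)), f t) - f x with hg
  have hgB : ∀ p : ℕ × ℕ, |g (p.1 + p.2)| ≤ B p := fun p => by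
    have e : g (p.1 + p.2) = (n + 1) * ∫ t in (((p.1 + p.2 : ℕ) : ℝ) / (n + 1))..
        ((((p.1 + p.2 : ℕ) : ℝ) + 1) / (n + 1)), (f t - f x) := by
      rw [intervalIntegral.integral_sub (hint _) intervalIntegrable_const,
        intervalIntegral.integral_const, hlen, hg, smul_eq_mul]
      field_simp
    have hb := intervalIntegral.norm_integral_le_of_norm_le_const (C := B p)
      (a := ((p.1 + p.2 : ℕ) : ℝ) / (n + 1)) (b := (((p.1 + p.2 : ℕ) : ℝ) + 1) / (n + 1))
      (f := fun t => f t - f x) (fun t ht => by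
        rw [Set.uIoc_of_le (hcell _)] at ht
        have h1 := ht.1
        have h2 := ht.2
        rw [div_lt_iff₀ hn0] at h1
        rw [le_div_iff₀ hn0] at h2
        push_cast at h1 h2
        exact hf p t (by linarith) (by linarith))
    rw [hlen, abs_of_pos (by positivity), Real.norm_eq_abs] at hb
    rw [e, abs_mul, abs_of_pos hn0]
    calc _ ≤ ((n : ℝ) + 1) * (B p * (1 / (n + 1))) := by gcongr
      _ = B p := by field_simp
  obtain ⟨T, hT, hsum⟩ := exists_hasSum_Wgb_mul_of_abs_le ha n hx hB hgB
  have h := (hsum.add ((hasSum_Wgb ha hn hx).mul_right (f x))).mul_left (1 / ((n : ℝ) + 1))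
  have e : (fun k : ℕ => 1 / ((n : ℝ) + 1) * (Wgb a n k x * g k + Wgb a n k x * f x)) =
      fun k : ℕ => Wgb a n k x *
        ∫ t in ((k : ℝ) / (n + 1))..((k + 1) / (n + 1)), f t := by
    ext k
    rw [hg]
    field_simp
    ring
  rw [e] at h
  have hK : Kgb a n f x = T + f x := by
    rw [Kgb, h.tsum_eq]
    field_simp
  rw [hK, add_sub_cancel_right]
  exact hT

section Modulus

variable {f : ℝ → ℝ} {M δ : ℝ}

lemma bddAbove_weightedMod (hgrow : ∀ x : ℝ, 0 ≤ x → |f x| ≤ M * (1 + x ^ 2)) :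
    BddAbove {y | ∃ x h : ℝ, 0 ≤ x ∧ 0 < h ∧ h ≤ δ ∧
      y = |f (x + h) - f x| / (1 + (x + h) ^ 2)} := by
  refine ⟨2 * M, ?_⟩
  rintro y ⟨x, h, hx, hh, -, rfl⟩
  have hM : 0 ≤ M := by
    have := (abs_nonneg _).trans (hgrow 0 le_rfl)
    simpa using this
  rw [div_le_iff₀ (by positivity)]
  have h1 := hgrow (x + h) (by linarith)
  have h2 := hgrow x hx
  have h3 : M * (1 + x ^ 2) ≤ M * (1 + (x + h) ^ 2) := by gcongr; linarith
  have := abs_sub (f (x + h)) (f x)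
  linarith

lemma weightedMod_nonneg : 0 ≤ weightedMod f δ := by
  refine Real.sSup_nonneg ?_
  rintro y ⟨x, h, -, -, -, rfl⟩
  positivity

lemma abs_sub_le_weightedMod (hgrow : ∀ x : ℝ, 0 ≤ x → |f x| ≤ M * (1 + x ^ 2))
    {x t : ℝ} (hx : 0 ≤ x) (hxt : x ≤ t) (ht : t - x ≤ δ) :
    |f t - f x| ≤ (1 + t ^ 2) * weightedMod f δ := by
  rcases hxt.eq_or_lt with rfl | hlt
  · rw [sub_self, abs_zero]
    exact mul_nonneg (by positivity) weightedMod_nonneg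
  · have := le_csSup (bddAbove_weightedMod (δ := δ) hgrow)
      ⟨x, t - x, hx, by linarith, ht, rfl⟩
    rw [add_sub_cancel, div_le_iff₀ (by positivity)] at this
    rw [mul_comm]
    exact this

lemma abs_sub_le_nat_mul_weightedMod (hgrow : ∀ x : ℝ, 0 ≤ x → |f x| ≤ M * (1 + x ^ 2))
    {x : ℝ} (hx : 0 ≤ x) (m : ℕ) {t : ℝ} (hxt : x ≤ t) (ht : t - x ≤ m * δ) :
    |f t - f x| ≤ m * ((1 + t ^ 2) * weightedMod f δ) := by
  induction m generalizing t with
  | zero =>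
    obtain rfl : t = x := by simp at ht; linarith
    simp
  | succ m ih =>
    have hΩ : 0 ≤ weightedMod f δ := weightedMod_nonneg
    push_cast at ht ⊢
    have hδ : 0 ≤ δ := by
      by_contra! h
      nlinarith [Nat.cast_nonneg (α := ℝ) m]
    set y := max x (t - δ) with hy
    have hxy : x ≤ y := le_max_left _ _
    have hyt : y ≤ t := max_le hxt (by linarith)
    have h1 := ih hxy (by
      rcases max_cases x (t - δ) with h | h
      · have : 0 ≤ (m : ℝ) * δ := by positivity
        linarith
      · linarith)
    have h2 := abs_sub_le_weightedMod hgrow (hx.trans hxy) hyt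
      (δ := δ) (by linarith [le_max_right x (t - δ)])
    have h3 : (m : ℝ) * ((1 + y ^ 2) * weightedMod f δ)
        ≤ m * ((1 + t ^ 2) * weightedMod f δ) := by
      have := hx.trans hxy
      gcongr
    have := abs_sub_le (f t) (f y) (f x)
    linarith

lemma abs_sub_le_one_add_mul_weightedMod
    (hgrow : ∀ x : ℝ, 0 ≤ x → |f x| ≤ M * (1 + x ^ 2)) (hδ : 0 < δ)
    {x t : ℝ} (hx : 0 ≤ x) (ht : 0 ≤ t) :
    |f t - f x| ≤ (1 + |t - x| / δ) * (1 + x ^ 2 + t ^ 2) * weightedMod f δ := by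
  have hΩ : 0 ≤ weightedMod f δ := weightedMod_nonneg
  have key : ∀ u v : ℝ, 0 ≤ u → u ≤ v →
      |f v - f u| ≤ (1 + (v - u) / δ) * (1 + u ^ 2 + v ^ 2) * weightedMod f δ := by
    intro u v hu huv
    have h0 : 0 ≤ (v - u) / δ := div_nonneg (by linarith) hδ.le
    refine (abs_sub_le_nat_mul_weightedMod hgrow hu ⌈(v - u) / δ⌉₊ huv
      ((div_le_iff₀ hδ).mp (Nat.le_ceil _))).trans ?_
    rw [mul_assoc]
    gcongr
    · linarith [Nat.ceil_lt_add_one h0]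
    · linarith [sq_nonneg u]
  rcases le_total x t with h | h
  · rw [abs_of_nonneg (sub_nonneg.mpr h)]
    exact key x t hx h
  · rw [abs_sub_comm, abs_sub_comm t, abs_of_nonneg (sub_nonneg.mpr h)]
    convert key t x ht h using 2
    ring

end Modulus

/-- The growth factor of the modulus is at most quadratic in `r * |t - x|` and `t ^ 2`. -/
lemma one_add_mul_le {r q s x t : ℝ} (hs : 1 ≤ s) (hx : 1 + x ^ 2 ≤ s ^ 2) (hr : 0 ≤ r)
    (hq : 0 ≤ q) :
    (1 + r * q) * (1 + x ^ 2 + t ^ 2)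
      ≤ 3 * s ^ 2 + 2 * s ^ 2 * (r ^ 2 * q ^ 2) + 2 * t ^ 4 := by
  have hs2 : 1 ≤ s ^ 2 := one_le_pow₀ hs
  have h0 : 0 ≤ r * q := mul_nonneg hr hq
  have h1 : (1 + r * q) * (1 + x ^ 2 + t ^ 2) ≤ (1 + r * q) * (s ^ 2 + t ^ 2) := by
    gcongr
  have h2 : r * q ≤ 1 + (r * q) ^ 2 := by nlinarith [sq_nonneg (r * q - 1)]
  have h3 : s ^ 2 * (r * q) ≤ s ^ 2 * (1 + (r * q) ^ 2) := by gcongr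
  have h4 : t ^ 2 ≤ 1 + t ^ 4 := by nlinarith [sq_nonneg (t ^ 2 - 1)]
  have h5 : r * q * t ^ 2 ≤ (r * q) ^ 2 + t ^ 4 := by nlinarith [sq_nonneg (r * q - t ^ 2)]
  have h6 : (r * q) ^ 2 ≤ s ^ 2 * (r * q) ^ 2 := le_mul_of_one_le_left (sq_nonneg _) hs2
  nlinarith

lemma cell_moment_bound {n x i j t : ℝ} (hn : 1 ≤ n) (hx : 0 ≤ x) (hi : 0 ≤ i) (hj : 0 ≤ j)
    (h1 : i + j ≤ (n + 1) * t) (h2 : (n + 1) * t ≤ i + j + 1) :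
    n * (t - x) ^ 2 ≤ 2 * ((i - n * x) ^ 2 / n) + 2 * (1 + x) ^ 2 * (j + 1) ^ 4 ∧
      t ^ 4 ≤ 8 * ((n + i) ^ 4 / n ^ 4) + 8 * (j + 1) ^ 4 := by
  have hn0 : 0 < n := by linarith
  have ht : 0 ≤ t := by nlinarith
  constructor
  · have e : (n + 1) * (t - x) = (i - n * x) + ((n + 1) * t - i - x) := by ring
    have hv : ((n + 1) * t - i - x) ^ 2 ≤ (1 + x) ^ 2 * (j + 1) ^ 4 := by
      have ha : ((n + 1) * t - i - x) ^ 2 ≤ ((1 + x) * (j + 1)) ^ 2 := by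
        apply sq_le_sq'
        · nlinarith [mul_nonneg hx hj]
        · nlinarith [mul_nonneg hx hj]
      have hb : (j + 1) ^ 2 ≤ (j + 1) ^ 4 := pow_le_pow_right₀ (by linarith) (by norm_num)
      calc _ ≤ _ := ha
        _ = (1 + x) ^ 2 * (j + 1) ^ 2 := by ring
        _ ≤ _ := by gcongr
    have hsq : n ^ 2 * (t - x) ^ 2
        ≤ 2 * (i - n * x) ^ 2 + 2 * ((1 + x) ^ 2 * (j + 1) ^ 4) := by
      have : n ^ 2 * (t - x) ^ 2 ≤ ((n + 1) * (t - x)) ^ 2 := by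
        rw [mul_pow]; gcongr; linarith
      rw [e] at this
      nlinarith [sq_nonneg ((i - n * x) - ((n + 1) * t - i - x))]
    have hP : 0 ≤ (1 + x) ^ 2 * (j + 1) ^ 4 := by positivity
    have : n * (n * (t - x) ^ 2)
        ≤ n * (2 * ((i - n * x) ^ 2 / n) + 2 * (1 + x) ^ 2 * (j + 1) ^ 4) := by
      have e2 : n * (2 * ((i - n * x) ^ 2 / n)) = 2 * (i - n * x) ^ 2 := by field_simp
      rw [mul_add, e2]
      nlinarith
    exact le_of_mul_le_mul_left this hn0
  · have hle : t ≤ (n + i) / n + (j + 1) := by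
      have : (n + i) / n + (j + 1) = (n + i + n * (j + 1)) / n := by field_simp
      rw [this, le_div_iff₀ hn0]
      nlinarith
    calc t ^ 4 ≤ ((n + i) / n + (j + 1)) ^ 4 := by gcongr
      _ ≤ 2 ^ 3 * (((n + i) / n) ^ 4 + (j + 1) ^ 4) := by
        exact add_pow_le (by positivity) (by positivity) 4
      _ = _ := by rw [div_pow]; ring

/-- Error estimate with the fourth power weight `(1 + x) ^ 4`. -/
lemma abs_Kgb_sub_le_weightedMod {a M : ℝ} (ha : 0 ≤ a) {f : ℝ → ℝ}
    (hcont : ContinuousOn f (Set.Ici 0))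
    (hgrow : ∀ x : ℝ, 0 ≤ x → |f x| ≤ M * (1 + x ^ 2)) {n : ℕ} (hn : 1 ≤ n)
    {x : ℝ} (hx : 0 ≤ x) :
    |Kgb a n f x - f x| ≤ (391 + 480 * Real.exp (1 + a * Real.exp 1)) * (1 + x) ^ 4 *
      weightedMod f ((n : ℝ) ^ (-(1 : ℝ) / 2)) := by
  set δ : ℝ := (n : ℝ) ^ (-(1 : ℝ) / 2) with hδ
  set Ω := weightedMod f δ
  have hΩ : 0 ≤ Ω := weightedMod_nonneg
  have hn1 : (1 : ℝ) ≤ n := by exact_mod_cast hn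
  have hn0 : (0 : ℝ) < n := by linarith
  have hδ0 : 0 < δ := Real.rpow_pos_of_pos hn0 _
  have hδn : (δ⁻¹) ^ 2 = n := by
    rw [hδ, ← Real.rpow_neg hn0.le, ← Real.rpow_natCast, ← Real.rpow_mul hn0.le]
    norm_num
  set s : ℝ := 1 + x with hs
  have hs1 : 1 ≤ s := by linarith
  set l : ℝ := a * x / (1 + x) with hl
  have hl0 : 0 ≤ l := by positivity
  have hla : l ≤ a := by
    rw [hl, div_le_iff₀ (by positivity)]; nlinarith
  set E : ℝ := Real.exp (-l) * Real.exp 1 * Real.exp (l * Real.exp 1) with hE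
  have hEle : E ≤ Real.exp (1 + a * Real.exp 1) := by
    rw [hE, ← Real.exp_add, ← Real.exp_add]
    have := mul_le_mul_of_nonneg_right hla (Real.exp_pos 1).le
    exact Real.exp_le_exp.mpr (by linarith)
  have hN1 : HasSum (fun i => negBinomialWeight n x i * 1) 1 := by
    simpa using hasSum_negBinomialWeight hn hx
  have hP1 : HasSum (fun j => poissonWeight l j * 1) 1 := by
    simpa using hasSum_poissonWeight l
  have A0 := hasSum_negBinomialWeight_mul_poissonWeight (u := fun _ => 1) (v := fun _ => 1)
    hx hl0 (fun _ => zero_le_one) (fun _ => zero_le_one) hN1 hP1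
  have A1 := hasSum_negBinomialWeight_mul_poissonWeight
    (u := fun i => ((i : ℝ) - n * x) ^ 2) (v := fun _ => 1)
    hx hl0 (fun _ => sq_nonneg _) (fun _ => zero_le_one)
    (hasSum_negBinomialWeight_mul_sq hn hx) hP1
  have A2 := hasSum_negBinomialWeight_mul_poissonWeight
    (u := fun i => ((n + i).ascFactorial 4 : ℝ)) (v := fun _ => 1)
    hx hl0 (fun _ => Nat.cast_nonneg _) (fun _ => zero_le_one)
    (hasSum_negBinomialWeight_mul_ascFactorial hn hx 4) hP1
  have A3 := hasSum_negBinomialWeight_mul_poissonWeight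
    (u := fun _ => 1) (v := fun j => Real.exp (j + 1))
    hx hl0 (fun _ => zero_le_one) (fun _ => (Real.exp_pos _).le) hN1
    (hasSum_poissonWeight_mul_exp l)
  have A := ((((A0.mul_left (3 * s ^ 2)).add (A1.mul_left (4 * s ^ 2 / n))).add
    (A2.mul_left (16 / (n : ℝ) ^ 4))).add
    (A3.mul_left (96 * s ^ 4 + 384))).mul_left Ω
  have hB : HasSum (fun p : ℕ × ℕ => negBinomialWeight n x p.1 * poissonWeight l p.2 *
      ((3 * s ^ 2 + 4 * s ^ 2 / n * ((p.1 : ℝ) - n * x) ^ 2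
        + 16 / (n : ℝ) ^ 4 * ((n + p.1).ascFactorial 4 : ℝ)
        + (96 * s ^ 4 + 384) * Real.exp (p.2 + 1)) * Ω))
      (Ω * (3 * s ^ 2 * (1 * 1) + 4 * s ^ 2 / n * (n * x * s * 1) +
        16 / (n : ℝ) ^ 4 * ((n.ascFactorial 4 : ℝ) * s ^ 4 * 1) +
        (96 * s ^ 4 + 384) * (1 * E))) := by
    convert! A using 1
    ext p
    ring
  refine (abs_Kgb_sub_le ha hn hx hcont hB ?_).trans ?_
  · intro p t h1 h2
    have ht : 0 ≤ t := by
      have : 0 ≤ ((n : ℝ) + 1) * t := le_trans (by positivity) h1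
      exact nonneg_of_mul_nonneg_right this (by positivity)
    refine (abs_sub_le_one_add_mul_weightedMod hgrow hδ0 hx ht).trans ?_
    refine mul_le_mul_of_nonneg_right ?_ hΩ
    obtain ⟨hc1, hc2⟩ := cell_moment_bound hn1 hx (Nat.cast_nonneg p.1) (Nat.cast_nonneg p.2) h1 h2
    have hk := one_add_mul_le (r := δ⁻¹) (q := |t - x|) (x := x) (t := t) hs1
      (by rw [hs]; nlinarith) (by positivity) (abs_nonneg _)
    rw [hδn, sq_abs, mul_comm δ⁻¹, ← div_eq_mul_inv] at hk
    have hasc : ((n : ℝ) + p.1) ^ 4 / (n : ℝ) ^ 4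
        ≤ ((n + p.1).ascFactorial 4 : ℝ) / (n : ℝ) ^ 4 := by
      gcongr
      exact_mod_cast Nat.pow_succ_le_ascFactorial (n + p.1) 4
    have hexp : ((p.2 : ℝ) + 1) ^ 4 ≤ 24 * Real.exp (p.2 + 1) := by
      have := Real.pow_div_factorial_le_exp (x := (p.2 : ℝ) + 1) (by positivity) 4
      rw [div_le_iff₀ (by positivity)] at this
      norm_num [Nat.factorial] at this
      linarith
    have hs0 : 0 ≤ 2 * s ^ 2 := by positivity
    have hc1' := mul_le_mul_of_nonneg_left hc1 hs0
    have hexp' := mul_le_mul_of_nonneg_left hexp (show 0 ≤ 4 * s ^ 4 + 16 by positivity)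
    calc _ ≤ _ := hk
      _ ≤ 3 * s ^ 2 + 2 * s ^ 2 * (2 * (((p.1 : ℝ) - n * x) ^ 2 / n)
            + 2 * s ^ 2 * ((p.2 : ℝ) + 1) ^ 4)
          + 2 * (8 * (((n + p.1).ascFactorial 4 : ℝ) / (n : ℝ) ^ 4)
            + 8 * ((p.2 : ℝ) + 1) ^ 4) := by linarith
      _ = 3 * s ^ 2 + 4 * s ^ 2 / n * ((p.1 : ℝ) - n * x) ^ 2
          + 16 / (n : ℝ) ^ 4 * ((n + p.1).ascFactorial 4 : ℝ)
          + (4 * s ^ 4 + 16) * ((p.2 : ℝ) + 1) ^ 4 := by ring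
      _ ≤ _ := by linarith
  · rw [mul_comm Ω]
    refine mul_le_mul_of_nonneg_right ?_ hΩ
    have hs24 : s ^ 2 ≤ s ^ 4 := pow_le_pow_right₀ hs1 (by norm_num)
    have hs4 : 1 ≤ s ^ 4 := one_le_pow₀ hs1
    have e1 : 4 * s ^ 2 / n * (n * x * s * 1) ≤ 4 * s ^ 4 := by
      have : 4 * s ^ 2 / n * (n * x * s * 1) = 4 * s ^ 2 * (x * s) := by field_simp
      rw [this]
      have : x * s ≤ s * s := by gcongr; linarith
      nlinarith [sq_nonneg s]
    have e2 : 16 / (n : ℝ) ^ 4 * ((n.ascFactorial 4 : ℝ) * s ^ 4 * 1) ≤ 384 * s ^ 4 := by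
      have h : (n.ascFactorial 4 : ℝ) ≤ 24 * (n : ℝ) ^ 4 := by
        exact_mod_cast Nat.ascFactorial_le_factorial_mul_pow n 4
      calc _ ≤ 16 / (n : ℝ) ^ 4 * (24 * (n : ℝ) ^ 4 * s ^ 4 * 1) := by gcongr
        _ = _ := by field_simp; norm_num
    have e3 : (96 * s ^ 4 + 384) * (1 * E)
        ≤ 480 * Real.exp (1 + a * Real.exp 1) * s ^ 4 := by
      calc _ ≤ (96 * s ^ 4 + 384 * s ^ 4) * (1 * Real.exp (1 + a * Real.exp 1)) := by
            gcongr; linarith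
        _ = _ := by ring
    linarith

/-- quantitative weighted approximation. -/
theorem statement5 (a M : ℝ) (ha : 0 ≤ a) (f : ℝ → ℝ)
    (hcont : ContinuousOn f (Set.Ici 0))
    (hgrow : ∀ x : ℝ, 0 ≤ x → |f x| ≤ M * (1 + x ^ 2))
    (hlim : ∃ L : ℝ, Tendsto (fun x : ℝ => f x / (1 + x ^ 2)) atTop (nhds L)) :
    ∃ M₁ > (0 : ℝ), ∀ n : ℕ, 1 ≤ n →
      (⨆ x : Set.Ici (0 : ℝ),
          |Kgb a n f x - f x| / (1 + (x : ℝ) ^ 2) ^ ((5 : ℝ) / 2)) ≤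
        M₁ * weightedMod f ((n : ℝ) ^ (-(1 : ℝ) / 2)) := by
  refine ⟨4 * (391 + 480 * Real.exp (1 + a * Real.exp 1)), by positivity, fun n hn => ?_⟩
  refine ciSup_le fun ⟨x, hx⟩ => ?_
  have hx0 : (0 : ℝ) ≤ x := hx
  have hΩ : 0 ≤ weightedMod f ((n : ℝ) ^ (-(1 : ℝ) / 2)) := weightedMod_nonneg
  rw [div_le_iff₀ (by positivity)]
  refine (abs_Kgb_sub_le_weightedMod ha hcont hgrow hn hx0).trans ?_
  have h1 : (1 + x) ^ 4 ≤ 4 * (1 + x ^ 2) ^ ((5 : ℝ) / 2) := by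
    have h2 : (1 + x ^ 2) ^ (2 : ℝ) ≤ (1 + x ^ 2) ^ ((5 : ℝ) / 2) :=
      Real.rpow_le_rpow_of_exponent_le (by nlinarith) (by norm_num)
    rw [Real.rpow_two] at h2
    have h3 : (1 + x) ^ 2 ≤ 2 * (1 + x ^ 2) := by nlinarith [sq_nonneg (x - 1)]
    have h4 := pow_le_pow_left₀ (sq_nonneg _) h3 2
    nlinarith
  calc _ ≤ (391 + 480 * Real.exp (1 + a * Real.exp 1)) *
        (4 * (1 + x ^ 2) ^ ((5 : ℝ) / 2)) *
        weightedMod f ((n : ℝ) ^ (-(1 : ℝ) / 2)) := by gcongr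
    _ = _ := by ring
end
end
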